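/- arXiv:2004.00603 — 2 statements merged into one kernel-verified Lean document; each statement's English description precedes it below -/
import Mathlib

section
/- Fix T ≥ 1, plans π^1,…,π^T, indicator weights b_1,…,b_T ∈ {0,1}, and per-iteration immediate utilities u^t(I,a) ∈ ℝ. For each infoset I define the local parameterized utility û^t_I(a) = u^t(I,a) + Σ_{I' ∈ C(I,a)} V^t_{I'}(π^t), and the subtree regret R_I = max over all plans π̂ of Σ_{t=1}^T b_t ( V^t_I(π̂) − V^t_I(π^t) ). Then for every infoset I, R_I = max_{a ∈ A(I)} { Σ_{t=1}^T b_t ( û^t_I(a) − û^t_I(π^t(I)) ) + Σ_{I' ∈ C(I,a)} R_{I'} }. -/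
/-- An abstract decision tree for a single player: a finite type of infosets, a nonempty finite
set of actions at each infoset, a children map, and a depth function decreasing along children. -/
structure DecisionTree (I α : Type*) where
  A : I → Finset α
  A_nonempty : ∀ i, (A i).Nonempty
  C : I → α → Finset I
  depth : I → ℕ
  depth_lt : ∀ i, ∀ a ∈ A i, ∀ j ∈ C i a, depth j < depth i

/-- The value function `V^u_I(π) = u(I, π(I)) + ∑_{I' ∈ C(I, π(I))} V^u_{I'}(π)`
(defined recursively; for plans `π` with `π i ∈ A i` everywhere the guard is always true). -/
noncomputable def DecisionTree.V {I α : Type*} [DecidableEq α] (D : DecisionTree I α)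
    (u : I → α → ℝ) (π : I → α) (i : I) : ℝ :=
  u i (π i) +
    (if h : π i ∈ D.A i then ∑ j ∈ (D.C i (π i)).attach, D.V u π j.1 else 0)
termination_by D.depth i
decreasing_by exact D.depth_lt i (π i) h j.1 j.2

/-- The descendant set `D(I) = {I} ∪ ⋃_{a ∈ A(I)} ⋃_{I' ∈ C(I,a)} D(I')`. -/
noncomputable def DecisionTree.desc {I α : Type*} [DecidableEq I] (D : DecisionTree I α)
    (i : I) : Finset I :=
  {i} ∪ (D.A i).attach.biUnion fun a => (D.C i a.1).attach.biUnion fun j => D.desc j.1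
termination_by D.depth i
decreasing_by exact D.depth_lt i a.1 a.2 j.1 j.2

namespace DecisionTree

variable {I α : Type*}

theorem V_eq_add_sum [DecidableEq α] (D : DecisionTree I α) (u : I → α → ℝ) {π : I → α} {i : I}
    (h : π i ∈ D.A i) : D.V u π i = u i (π i) + ∑ j ∈ D.C i (π i), D.V u π j := by
  rw [DecisionTree.V, dif_pos h, Finset.sum_attach _ (fun j => D.V u π j)]

theorem mem_desc_iff [DecidableEq I] (D : DecisionTree I α) {i k : I} :
    k ∈ D.desc i ↔ k = i ∨ ∃ a ∈ D.A i, ∃ j ∈ D.C i a, k ∈ D.desc j := by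
  rw [DecisionTree.desc]
  simp

theorem self_mem_desc [DecidableEq I] (D : DecisionTree I α) (i : I) : i ∈ D.desc i :=
  D.mem_desc_iff.mpr (Or.inl rfl)

theorem desc_subset_of_mem_C [DecidableEq I] (D : DecisionTree I α) {i j : I} {a : α}
    (ha : a ∈ D.A i) (hj : j ∈ D.C i a) : D.desc j ⊆ D.desc i :=
  fun _ hk => D.mem_desc_iff.mpr (Or.inr ⟨a, ha, j, hj, hk⟩)

theorem depth_le_of_mem_desc [DecidableEq I] (D : DecisionTree I α) {i k : I}
    (hk : k ∈ D.desc i) : D.depth k ≤ D.depth i := by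
  induction h : D.depth i using Nat.strong_induction_on generalizing i with
  | _ n ih =>
    subst h
    rcases D.mem_desc_iff.mp hk with rfl | ⟨a, ha, j, hj, hkj⟩
    · exact le_rfl
    · have hlt := D.depth_lt i a ha j hj
      exact (ih _ hlt hkj rfl).trans hlt.le

theorem notMem_desc_of_mem_C [DecidableEq I] (D : DecisionTree I α) {i j : I} {a : α}
    (ha : a ∈ D.A i) (hj : j ∈ D.C i a) : i ∉ D.desc j :=
  fun h => (D.depth_lt i a ha j hj).not_ge (D.depth_le_of_mem_desc h)

/-- The value at `i` depends only on the restriction of the plan to the descendants of `i`. -/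
theorem V_congr [DecidableEq I] [DecidableEq α] (D : DecisionTree I α) (u : I → α → ℝ)
    {π σ : I → α} {i : I} (hπ : ∀ k, π k ∈ D.A k) (hσ : ∀ k, σ k ∈ D.A k)
    (h : ∀ k ∈ D.desc i, π k = σ k) : D.V u π i = D.V u σ i := by
  induction hn : D.depth i using Nat.strong_induction_on generalizing i with
  | _ n ih =>
    subst hn
    rw [D.V_eq_add_sum u (hπ i), D.V_eq_add_sum u (hσ i), ← h i (D.self_mem_desc i)]
    congr 1
    refine Finset.sum_congr rfl fun j hj => ?_
    exact ih _ (D.depth_lt i _ (hπ i) j hj)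
      (fun k hk => h k (D.desc_subset_of_mem_C (hπ i) hj hk)) rfl

/-- Plans for the subtrees below the action `a` at `i` can be glued into one plan playing `a`. -/
theorem exists_glued_plan [DecidableEq I] (D : DecisionTree I α) {i : I} {a : α}
    (ha : a ∈ D.A i)
    (hdisj : ∀ j ∈ D.C i a, ∀ k ∈ D.C i a, j ≠ k → Disjoint (D.desc j) (D.desc k))
    (σ : I → I → α) (hσ : ∀ j k, σ j k ∈ D.A k) :
    ∃ τ : I → α, (∀ k, τ k ∈ D.A k) ∧ τ i = a ∧
      ∀ j ∈ D.C i a, ∀ k ∈ D.desc j, τ k = σ j k := by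
  classical
  let g : I → α := fun k =>
    if h : ∃ j ∈ D.C i a, k ∈ D.desc j then σ h.choose k else σ i k
  refine ⟨Function.update g i a, fun k => ?_, Function.update_self .., fun j hj k hk => ?_⟩
  · rcases eq_or_ne k i with rfl | hki
    · rwa [Function.update_self]
    · rw [Function.update_of_ne hki]
      dsimp only [g]
      split_ifs <;> exact hσ _ _
  · have hki : k ≠ i := fun h => D.notMem_desc_of_mem_C ha hj (h ▸ hk)
    have hex : ∃ j ∈ D.C i a, k ∈ D.desc j := ⟨j, hj, hk⟩
    have hc : hex.choose = j := by
      by_contra hne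
      exact Finset.disjoint_left.mp (hdisj _ hex.choose_spec.1 j hj hne) hex.choose_spec.2 hk
    rw [Function.update_of_ne hki]
    dsimp only [g]
    rw [dif_pos hex, hc]

/-- The weighted regret of a plan splits into the local regret at `i` and the weighted regrets in
the child subtrees reached by the plan. -/
theorem sum_weighted_regret_eq [DecidableEq α] (D : DecisionTree I α) {ι : Type*} [Fintype ι]
    {π : ι → I → α} (b : ι → ℝ) (u : ι → I → α → ℝ) {τ : I → α} {i : I}
    (hπ : ∀ t, π t i ∈ D.A i) (hτ : τ i ∈ D.A i) :
    ∑ t, b t * (D.V (u t) τ i - D.V (u t) (π t) i) =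
      (∑ t, b t *
        ((u t i (τ i) + ∑ j ∈ D.C i (τ i), D.V (u t) (π t) j) -
          (u t i (π t i) + ∑ j ∈ D.C i (π t i), D.V (u t) (π t) j))) +
      ∑ j ∈ D.C i (τ i), ∑ t, b t * (D.V (u t) τ j - D.V (u t) (π t) j) := by
  rw [Finset.sum_comm, ← Finset.sum_add_distrib]
  refine Finset.sum_congr rfl fun t _ => ?_
  rw [D.V_eq_add_sum (u t) hτ, D.V_eq_add_sum (u t) (hπ t), ← Finset.mul_sum,
    Finset.sum_sub_distrib]
  ring

end DecisionTree

/-!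
Lemma (subtree regret decomposition): the subtree regret
`R_I = max_{π̂} ∑_t b_t (V^t_I(π̂) − V^t_I(π^t))` satisfies
`R_I = max_{a ∈ A(I)} { ∑_t b_t (û^t_I(a) − û^t_I(π^t(I))) + ∑_{I' ∈ C(I,a)} R_{I'} }`,
where `û^t_I(a) = u^t(I,a) + ∑_{I' ∈ C(I,a)} V^t_{I'}(π^t)`.
-/
theorem subtree_regret_decomposition {I α : Type*} [Fintype I] [DecidableEq I] [DecidableEq α]
    (D : DecisionTree I α)
    -- descendant sets of distinct children (under the same action) are pairwise disjoint
    (hdisj : ∀ i, ∀ a ∈ D.A i, ∀ j ∈ D.C i a, ∀ k ∈ D.C i a, j ≠ k →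
      Disjoint (D.desc j) (D.desc k))
    (T : ℕ) (hT : 1 ≤ T)
    (π : Fin T → I → α) (hπ : ∀ t, π t ∈ Fintype.piFinset D.A)
    (b : Fin T → ℝ) (hb : ∀ t, b t = 0 ∨ b t = 1)
    (u : Fin T → I → α → ℝ)
    (R : I → ℝ)
    (hR : ∀ i, R i = (Fintype.piFinset D.A).sup'
      (Fintype.piFinset_nonempty.mpr D.A_nonempty)
      fun πhat => ∑ t : Fin T, b t * (D.V (u t) πhat i - D.V (u t) (π t) i)) :
    ∀ i, R i = (D.A i).sup' (D.A_nonempty i) fun a =>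
      (∑ t : Fin T, b t *
        ((u t i a + ∑ j ∈ D.C i a, D.V (u t) (π t) j) -
          (u t i (π t i) + ∑ j ∈ D.C i (π t i), D.V (u t) (π t) j))) +
      ∑ j ∈ D.C i a, R j := by
  have hπ' : ∀ t k, π t k ∈ D.A k := fun t => Fintype.mem_piFinset.mp (hπ t)
  have hle : ∀ i, ∀ τ ∈ Fintype.piFinset D.A,
      ∑ t, b t * (D.V (u t) τ i - D.V (u t) (π t) i) ≤ R i := fun i τ hτ => by
    rw [hR i]
    exact Finset.le_sup' (fun τ => ∑ t, b t * (D.V (u t) τ i - D.V (u t) (π t) i)) hτ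
  have hopt : ∀ i, ∃ τ : I → α, (∀ k, τ k ∈ D.A k) ∧
      R i = ∑ t, b t * (D.V (u t) τ i - D.V (u t) (π t) i) := fun i => by
    obtain ⟨τ, hτ, h⟩ := Finset.exists_mem_eq_sup'
      (Fintype.piFinset_nonempty.mpr D.A_nonempty)
      (fun τ => ∑ t, b t * (D.V (u t) τ i - D.V (u t) (π t) i))
    exact ⟨τ, Fintype.mem_piFinset.mp hτ, (hR i).trans h⟩
  choose σ hσ hRσ using hopt
  intro i
  apply le_antisymm
  · rw [hRσ i, D.sum_weighted_regret_eq b u (fun t => hπ' t i) (hσ i i)]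
    refine Finset.le_sup'_of_le _ (hσ i i) (add_le_add_right ?_ _)
    exact Finset.sum_le_sum fun j _ => hle j _ (Fintype.mem_piFinset.mpr (hσ i))
  · refine Finset.sup'_le _ _ fun a ha => ?_
    obtain ⟨τ, hτ, rfl, hτσ⟩ := D.exists_glued_plan ha (hdisj i a ha) σ hσ
    refine le_trans (le_of_eq ?_) (hle i τ (Fintype.mem_piFinset.mpr hτ))
    rw [D.sum_weighted_regret_eq b u (fun t => hπ' t i) (hτ i)]
    congr 1
    refine Finset.sum_congr rfl fun j hj => ?_
    rw [hRσ j]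
    refine Finset.sum_congr rfl fun t _ => ?_
    rw [D.V_congr (u t) hτ (hσ j) (hτσ j hj)]
end

section
/- Let A and Â be finite nonempty sets, P a type, and (S_a)_{a ∈ A} pairwise disjoint subsets of P with union S = ⋃_{a ∈ A} S_a. Fix infinite sequences π^1, π^2, … ∈ P, functions f_t : Â → ℝ, and reals g_t for t ∈ ℕ. For T ≥ 1 write R_a(T) = max_{â ∈ Â} Σ_{t=1}^T 1[π^t ∈ S_a] ( f_t(â) − g_t ) and R(T) = max_{â ∈ Â} Σ_{t=1}^T 1[π^t ∈ S] ( f_t(â) − g_t ). If limsup_{T→∞} R_a(T)/T ≤ 0 for every a ∈ A, then limsup_{T→∞} R(T)/T ≤ 0. -/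
lemma EReal.limsup_coe_le_zero_iff {u : ℕ → ℝ} :
    Filter.limsup (fun n => (u n : EReal)) Filter.atTop ≤ 0 ↔
      ∀ ε : ℝ, 0 < ε → ∀ᶠ n in Filter.atTop, u n < ε := by
  refine ⟨fun h ε hε => ?_, fun h => ?_⟩
  · have hlt : Filter.limsup (fun n => (u n : EReal)) Filter.atTop < (ε : EReal) :=
      h.trans_lt (EReal.coe_pos.mpr hε)
    filter_upwards [Filter.eventually_lt_of_limsup_lt hlt] with n hn
    exact EReal.coe_lt_coe_iff.mp hn
  · refine EReal.le_of_forall_lt_iff_le.mp fun ε hε => ?_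
    refine Filter.limsup_le_of_le (by isBoundedDefault) ?_
    filter_upwards [h ε (EReal.coe_pos.mp hε)] with n hn
    exact EReal.coe_le_coe_iff.mpr hn.le

lemma Set.indicator_iUnion_eq_sum {A P : Type*} [Fintype A] (S : A → Set P)
    (hdisj : ∀ a b : A, a ≠ b → Disjoint (S a) (S b)) (φ : P → ℝ) (p : P) :
    Set.indicator (⋃ a, S a) φ p = ∑ a, Set.indicator (S a) φ p := by
  by_cases hp : p ∈ ⋃ a, S a
  · obtain ⟨a, ha⟩ := Set.mem_iUnion.mp hp
    rw [Set.indicator_of_mem hp, Fintype.sum_eq_single a, Set.indicator_of_mem ha]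
    intro b hb
    exact Set.indicator_of_notMem (Set.disjoint_right.mp (hdisj b a hb) ha) φ
  · rw [Set.indicator_of_notMem hp, Finset.sum_eq_zero]
    intro a _
    exact Set.indicator_of_notMem (fun ha => hp (Set.mem_iUnion_of_mem a ha)) φ

/-!
Lemma ("going up", o(T) form): if the sets `S a` (for `a ∈ A`) are pairwise disjoint with union
`S = ⋃ a, S a`, `R_a(T) = max_{â ∈ Â} ∑_{t<T} 1[π^t ∈ S_a](f_t(â) − g_t)` and
`R(T) = max_{â ∈ Â} ∑_{t<T} 1[π^t ∈ S](f_t(â) − g_t)`, and `limsup R_a(T)/T ≤ 0` for all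
`a ∈ A`, then `limsup R(T)/T ≤ 0`.
-/
theorem going_up_sublinear
    {A Ahat P : Type*} [Fintype A] [Nonempty A] [Fintype Ahat] [Nonempty Ahat]
    (S : A → Set P)
    (hdisj : ∀ a b : A, a ≠ b → Disjoint (S a) (S b))
    (π : ℕ → P) (f : ℕ → Ahat → ℝ) (g : ℕ → ℝ)
    (Ra : A → ℕ → ℝ) (R : ℕ → ℝ)
    (hRa : ∀ a T, Ra a T = (Finset.univ : Finset Ahat).sup' Finset.univ_nonempty
      fun ahat => ∑ t ∈ Finset.range T, Set.indicator (S a) (fun _ => f t ahat - g t) (π t))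
    (hR : ∀ T, R T = (Finset.univ : Finset Ahat).sup' Finset.univ_nonempty
      fun ahat => ∑ t ∈ Finset.range T, Set.indicator (⋃ a, S a) (fun _ => f t ahat - g t) (π t))
    (h : ∀ a : A,
      Filter.limsup (fun T : ℕ => ((Ra a T / (T : ℝ) : ℝ) : EReal)) Filter.atTop ≤ 0) :
    Filter.limsup (fun T : ℕ => ((R T / (T : ℝ) : ℝ) : EReal)) Filter.atTop ≤ 0 := by
  have hle : ∀ T, R T ≤ ∑ a, Ra a T := by
    intro T
    rw [hR]
    refine Finset.sup'_le _ _ fun ahat _ => ?_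
    simp_rw [Set.indicator_iUnion_eq_sum S hdisj]
    rw [Finset.sum_comm]
    refine Finset.sum_le_sum fun a _ => ?_
    rw [hRa]
    exact Finset.le_sup' (fun ahat => ∑ t ∈ Finset.range T,
      Set.indicator (S a) (fun _ => f t ahat - g t) (π t)) (Finset.mem_univ ahat)
  rw [EReal.limsup_coe_le_zero_iff]
  intro ε hε
  have hcard : (0 : ℝ) < Fintype.card A := Nat.cast_pos.mpr Fintype.card_pos
  have hev : ∀ᶠ T : ℕ in Filter.atTop, ∀ a, Ra a T / (T : ℝ) < ε / Fintype.card A :=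
    Filter.eventually_all.mpr fun a =>
      EReal.limsup_coe_le_zero_iff.mp (h a) _ (div_pos hε hcard)
  filter_upwards [hev] with T hT
  calc R T / (T : ℝ) ≤ (∑ a, Ra a T) / (T : ℝ) := by gcongr; exact hle T
    _ = ∑ a, Ra a T / (T : ℝ) := Finset.sum_div _ _ _
    _ < ∑ _a : A, ε / Fintype.card A :=
      Finset.sum_lt_sum_of_nonempty Finset.univ_nonempty fun a _ => hT a
    _ = ε := by
      rw [Finset.sum_const, Finset.card_univ, nsmul_eq_mul, mul_div_cancel₀ _ hcard.ne']
end
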